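/- arXiv:2509.20794 — 3 statements merged into one kernel-verified Lean document; each statement's English description precedes it below -/
import Mathlib

section
/- Let R be a finite commutative Frobenius ring. Let A be the (t+1)×(t+1) 0–1 matrix with A_{ij} = 1 iff a_iR ⊆ a_jR, let D = diag(|a_0R|, …, |a_tR|), and let Q be the 0–1 matrix with Q_{ij} = 1 iff a_jR ⊆ (a_iR)⊥ = {r ∈ R : a_i r = 0}. Then (Q D A^{−1})² = |R| · I, where I is the (t+1)×(t+1) identity matrix and A^{−1} is the inverse of A over ℚ. Consequently, Q is invertible over ℚ. -/
noncomputable section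
open scoped BigOperators

/-- The dual of a linear code `C ⊆ Rⁿ` with respect to the standard inner
product `u·v = ∑ ℓ, u ℓ * v ℓ`. -/
def dualCode {R : Type*} [CommRing R] {n : ℕ} (C : Submodule R (Fin n → R)) :
    Submodule R (Fin n → R) where
  carrier := {v | ∀ u ∈ C, ∑ ℓ, u ℓ * v ℓ = 0}
  add_mem' := by
    intro v w hv hw u hu
    simp only [Set.mem_setOf_eq] at *
    have h1 := hv u hu
    have h2 := hw u hu
    simp only [Pi.add_apply, mul_add, Finset.sum_add_distrib, h1, h2, add_zero]
  zero_mem' := by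
    intro u hu
    simp
  smul_mem' := by
    intro c v hv u hu
    simp only [Set.mem_setOf_eq] at *
    have h := hv u hu
    have : ∑ ℓ, u ℓ * (c • v) ℓ = c * ∑ ℓ, u ℓ * v ℓ := by
      rw [Finset.mul_sum]
      exact Finset.sum_congr rfl fun ℓ _ => by
        simp only [Pi.smul_apply, smul_eq_mul]; ring
    rw [this, h, mul_zero]

/-- A finite commutative ring is Frobenius iff `|C|·|C⊥| = |R|ⁿ` for every
linear code `C` of every length `n` over `R`. -/
def IsFrobeniusRing (R : Type*) [CommRing R] [Fintype R] : Prop :=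
  ∀ (n : ℕ) (C : Submodule R (Fin n → R)),
    Nat.card C * Nat.card (dualCode C) = Fintype.card R ^ n

open Classical

section FrobeniusAnnihilators

variable {R : Type*} [CommRing R]

/-- In a finite Frobenius ring, `|I|·|Ann I| = |R|` for every ideal `I`. -/
theorem IsFrobeniusRing.card_mul_card_annihilator [Fintype R] (hR : IsFrobeniusRing R)
    (I : Ideal R) : Nat.card I * Nat.card (Submodule.annihilator I) = Fintype.card R := by
  have h := hR 1 (Submodule.comap (LinearMap.proj (0 : Fin 1)) I)
  rw [pow_one] at h
  rw [← h]
  congr 1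
  · refine Nat.card_congr ((Equiv.funUnique (Fin 1) R).subtypeEquiv fun v => ?_).symm
    simp
  · refine Nat.card_congr ((Equiv.funUnique (Fin 1) R).subtypeEquiv fun v => ?_).symm
    simp only [dualCode, Submodule.mem_annihilator, smul_eq_mul, Finset.univ_unique,
      Fin.default_eq_zero, Finset.sum_singleton, Submodule.mem_mk, AddSubmonoid.mem_mk,
      AddSubsemigroup.mem_mk, Set.mem_ofPred_eq, Submodule.mem_comap, LinearMap.proj_apply,
      Equiv.funUnique_apply]
    constructor
    · intro hv r hr
      rw [mul_comm]
      exact hv (fun _ => r) hr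
    · intro hv u hu
      rw [mul_comm]
      exact hv _ hu

/-- Ideals of a finite Frobenius ring satisfy the double annihilator property. -/
theorem IsFrobeniusRing.annihilator_annihilator [Fintype R] (hR : IsFrobeniusRing R)
    (I : Ideal R) : Submodule.annihilator (Submodule.annihilator I) = I := by
  have hle : I ≤ Submodule.annihilator (Submodule.annihilator I) := fun x hx =>
    Submodule.mem_annihilator.2 fun y hy => by
      rw [smul_eq_mul, mul_comm]
      exact Submodule.mem_annihilator.1 hy x hx
  have h1 := hR.card_mul_card_annihilator I
  have h2 := hR.card_mul_card_annihilator (Submodule.annihilator I)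
  have hpos : 0 < Nat.card (Submodule.annihilator I) := Nat.card_pos
  have hcard : Nat.card (Submodule.annihilator (Submodule.annihilator I)) = Nat.card I := by
    refine Nat.eq_of_mul_eq_mul_left hpos ?_
    rw [h2, ← h1, mul_comm]
  refine (SetLike.coe_injective (Set.eq_of_subset_of_ncard_le hle ?_ (Set.toFinite _))).symm
  exact hcard.le

theorem IsFrobeniusRing.exists_ne_zero_mem_annihilator [Fintype R] (hR : IsFrobeniusRing R)
    {I : Ideal R} (hI : I ≠ ⊤) : ∃ s ∈ Submodule.annihilator I, s ≠ 0 := by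
  apply Submodule.exists_mem_ne_zero_of_ne_bot
  intro h
  apply hI
  rw [← hR.annihilator_annihilator I, h, Submodule.annihilator_bot]

/-- Nonzero elements annihilated by pairwise distinct maximal ideals have no vanishing
nonempty subsums. -/
theorem MaximalSpectrum.eq_empty_of_sum_eq_zero {s : MaximalSpectrum R → R}
    (hs : ∀ m, s m ∈ Submodule.annihilator m.asIdeal) (hs0 : ∀ m, s m ≠ 0)
    {S : Finset (MaximalSpectrum R)} (h : ∑ m ∈ S, s m = 0) : S = ∅ := by
  by_contra hne
  obtain ⟨m, hm⟩ := Finset.nonempty_iff_ne_empty.2 hne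
  have hnle : ¬ ((S.erase m).inf fun m' => m'.asIdeal) ≤ m.asIdeal := by
    intro hle
    obtain ⟨m', hm', hle'⟩ := (Ideal.IsPrime.inf_le' m.isMaximal.isPrime).1 hle
    exact (Finset.mem_erase.1 hm').1
      (MaximalSpectrum.ext (m'.isMaximal.eq_of_le m.isMaximal.ne_top hle'))
  obtain ⟨r, hr, hrm⟩ := SetLike.not_le_iff_exists.1 hnle
  have hrs : r * s m = 0 := by
    rw [← Finset.add_sum_erase S s hm] at h
    have h0 : r * ∑ m' ∈ S.erase m, s m' = 0 := by
      rw [Finset.mul_sum]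
      refine Finset.sum_eq_zero fun m' hm' => ?_
      rw [mul_comm]
      exact Submodule.mem_annihilator.1 (hs m') r (Submodule.mem_finsetInf.1 hr m' hm')
    have := congrArg (r * ·) h
    simpa [mul_add, h0] using this
  obtain ⟨y, i, hi, hy⟩ := m.isMaximal.exists_inv hrm
  apply hs0 m
  have hi0 : s m * i = 0 := Submodule.mem_annihilator.1 (hs m) i hi
  calc s m = (y * r + i) * s m := by rw [hy, one_mul]
    _ = y * (r * s m) + s m * i := by ring
    _ = 0 := by rw [hrs, hi0]; ring

/-- The alternating sum over subsets vanishes on functions with a period in the family. -/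
theorem Finset.sum_neg_one_pow_card_mul_eq_zero {ι M : Type*} [Fintype ι] [AddCommMonoid M]
    (s : ι → M) (m : ι) (N : M → ℚ) (hN : ∀ y, N (s m + y) = N y) :
    ∑ S : Finset ι, (-1 : ℚ) ^ S.card * N (∑ i ∈ S, s i) = 0 := by
  rw [← Finset.powerset_univ, ← Finset.insert_erase (Finset.mem_univ m),
    Finset.sum_powerset_insert (Finset.notMem_erase _ _), ← Finset.sum_add_distrib]
  refine Finset.sum_eq_zero fun S hS => ?_
  have hm : m ∉ S := fun h => Finset.notMem_erase _ _ (Finset.mem_powerset.1 hS h)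
  rw [Finset.card_insert_of_notMem hm, Finset.sum_insert hm, hN, pow_succ]
  ring

/-- A rational-valued substitute for the generating character of a finite Frobenius ring. -/
theorem IsFrobeniusRing.exists_generating_function [Fintype R] (hR : IsFrobeniusRing R) :
    ∃ φ : R → ℚ, ∀ (x : R) (I : Ideal R), ∑ r : R, (if r ∈ I then φ (x * r) else 0) =
      if ∀ r ∈ I, x * r = 0 then (Nat.card I : ℚ) else 0 := by
  have := Fintype.ofFinite (MaximalSpectrum R)
  choose s hs hs0 using fun m : MaximalSpectrum R =>
    hR.exists_ne_zero_mem_annihilator m.isMaximal.ne_top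
  refine ⟨fun y => ∑ S : Finset (MaximalSpectrum R),
    (-1 : ℚ) ^ S.card * (if ∑ m ∈ S, s m = y then 1 else 0), fun x I => ?_⟩
  split_ifs with hx
  · rw [← Finset.sum_filter, Finset.sum_congr rfl (g := fun _ => (1 : ℚ))]
    · simp [Nat.card_eq_fintype_card, Fintype.card_subtype]
    · intro r hr
      rw [hx r (Finset.mem_filter.1 hr).2]
      beta_reduce
      rw [Finset.sum_eq_single ∅]
      · simp
      · intro S _ hS
        rw [if_neg fun h => hS (MaximalSpectrum.eq_empty_of_sum_eq_zero hs hs0 h), mul_zero]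
      · simp
  · obtain ⟨r₁, hr₁, hxr₁⟩ : ∃ r ∈ I, x * r ≠ 0 := by simpa using hx
    have htop : Submodule.annihilator (Ideal.span {x} * I) ≠ ⊤ := by
      intro h
      rw [Submodule.annihilator_eq_top_iff] at h
      apply hxr₁
      have := Ideal.mul_mem_mul (Ideal.mem_span_singleton_self x) hr₁
      rwa [h] at this
    obtain ⟨m, hm, hle⟩ := Ideal.exists_le_maximal _ htop
    have hmem : s ⟨m, hm⟩ ∈ Ideal.span {x} * I := by
      rw [← hR.annihilator_annihilator (Ideal.span {x} * I)]
      exact Submodule.annihilator_mono hle (hs ⟨m, hm⟩)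
    obtain ⟨r₀, hr₀, hxr₀⟩ := Ideal.mem_span_singleton_mul.1 hmem
    refine Eq.trans ?_ (Finset.sum_neg_one_pow_card_mul_eq_zero s ⟨m, hm⟩
      (fun y => ∑ r : R, if r ∈ I then (if y = x * r then 1 else 0) else 0) ?_)
    · simp only [Finset.mul_sum]
      rw [Finset.sum_comm]
      refine Finset.sum_congr rfl fun r _ => ?_
      split_ifs with hr
      · rfl
      · simp
    · intro y
      refine (Fintype.sum_equiv (Equiv.addLeft r₀) _ _ fun r => ?_).symm
      simp only [Equiv.coe_addLeft, mul_add, hxr₀, add_right_inj, I.add_mem_iff_right hr₀]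

end FrobeniusAnnihilators

/-- The zeta matrix of a finite poset, indexed along an injection, is invertible. -/
theorem Matrix.isUnit_of_le_indicator {ι α : Type*} [Fintype ι] [DecidableEq ι] [PartialOrder α] {f : ι → α}
    (hf : Function.Injective f) {A : Matrix ι ι ℚ}
    (hA : ∀ i j, A i j = if f i ≤ f j then 1 else 0) : IsUnit A := by
  rw [← Matrix.mulVec_injective_iff_isUnit, ← Matrix.coe_mulVecLin, ← LinearMap.ker_eq_bot,
    LinearMap.ker_eq_bot']
  intro v hv
  let _ : PartialOrder ι := PartialOrder.lift f hf
  funext i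
  induction i using WellFoundedGT.induction with
  | _ i ih =>
    have h := congrFun hv i
    rw [Matrix.mulVecLin_apply, Matrix.mulVec, dotProduct, Finset.sum_eq_single i] at h
    · simpa [hA] using h
    · intro j _ hj
      rw [hA]
      split_ifs with hij
      · rw [ih j (lt_of_le_of_ne hij hj.symm), Pi.zero_apply, mul_zero]
      · rw [zero_mul]
    · simp

/-- `(Q D A⁻¹)² = |R| · I`, and consequently `Q` is invertible
over `ℚ`. -/
theorem stmt10 {R : Type*} [CommRing R] [Fintype R] (hR : IsFrobeniusRing R)
    {t : ℕ} (a : Fin (t + 1) → R)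
    (hrep : ∀ r : R, ∃ i, Ideal.span {r} = Ideal.span {a i})
    (hinj : ∀ i j, Ideal.span {a i} = Ideal.span {a j} → i = j)
    (A D Q : Matrix (Fin (t + 1)) (Fin (t + 1)) ℚ)
    (hA : ∀ i j, A i j = if Ideal.span {a i} ≤ Ideal.span {a j} then 1 else 0)
    (hD : D = Matrix.diagonal fun i => (Nat.card (Ideal.span {a i}) : ℚ))
    (hQ : ∀ i j, Q i j =
      if ∀ r ∈ Ideal.span {a j}, a i * r = 0 then 1 else 0) :
    (Q * D * A⁻¹) ^ 2 = (Fintype.card R : ℚ) • (1 : Matrix (Fin (t + 1)) (Fin (t + 1)) ℚ) ∧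
      IsUnit Q := by
  obtain ⟨φ, hφ⟩ := hR.exists_generating_function
  have hAu : IsUnit A.det := (Matrix.isUnit_iff_isUnit_det A).1
    (Matrix.isUnit_of_le_indicator (f := fun i => Ideal.span {a i}) (fun i j => hinj i j) hA)
  let K : Matrix (Fin (t + 1)) (Fin (t + 1)) ℚ := fun i j =>
    ∑ r : R, if Ideal.span {r} = Ideal.span {a j} then φ (a i * r) else 0
  have hsum : ∀ (i : Fin (t + 1)) (I : Ideal R) (F : Fin (t + 1) → ℚ),
      (∀ j, F j = if a j ∈ I then 1 else 0) →
      ∑ j, K i j * F j = if ∀ r ∈ I, a i * r = 0 then (Nat.card I : ℚ) else 0 := by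
    intro i I F hF
    rw [← hφ]
    simp only [K, Finset.sum_mul]
    rw [Finset.sum_comm]
    refine Finset.sum_congr rfl fun r _ => ?_
    obtain ⟨j₀, hj₀⟩ := hrep r
    rw [Finset.sum_eq_single j₀]
    · have hmem : r ∈ I ↔ a j₀ ∈ I := by
        rw [← Ideal.span_singleton_le_iff_mem, hj₀, Ideal.span_singleton_le_iff_mem]
      simp [hj₀, hF, hmem]
    · intro j _ hj
      rw [if_neg fun h => hj (hinj _ _ (h.symm.trans hj₀)), zero_mul]
    · simp
  have hKA : K * A = Q * D := by
    ext i l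
    rw [Matrix.mul_apply, hsum i (Ideal.span {a l}) (fun j => A j l)
      (fun j => by simp only [hA, Ideal.span_singleton_le_iff_mem]), hD, Matrix.mul_diagonal, hQ,
      ite_mul, one_mul, zero_mul]
  have hKQD : K * (Q * D) = (Fintype.card R : ℚ) • A := by
    ext i l
    have hann : ∀ x, x ∈ Submodule.annihilator (Ideal.span {a l}) ↔
        ∀ r ∈ Ideal.span {a l}, x * r = 0 := fun x => Submodule.mem_annihilator
    have hiff : (∀ r ∈ Submodule.annihilator (Ideal.span {a l}), a i * r = 0) ↔
        Ideal.span {a i} ≤ Ideal.span {a l} := by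
      rw [Ideal.span_singleton_le_iff_mem, ← hR.annihilator_annihilator (Ideal.span {a l}),
        Submodule.mem_annihilator, hR.annihilator_annihilator]
      rfl
    rw [← Matrix.mul_assoc, hD, Matrix.mul_diagonal, Matrix.mul_apply,
      hsum i (Submodule.annihilator (Ideal.span {a l})) (fun j => Q j l)
        (fun j => by simp only [hQ, hann]),
      Matrix.smul_apply, hA, ← hR.card_mul_card_annihilator (Ideal.span {a l})]
    simp only [hiff]
    split_ifs
    · push_cast
      rw [smul_eq_mul]
      ring
    · simp
  have hK : Q * D * A⁻¹ = K := by rw [← hKA, Matrix.mul_nonsing_inv_cancel_right _ _ hAu]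
  have hsq : (Q * D * A⁻¹) ^ 2 =
      (Fintype.card R : ℚ) • (1 : Matrix (Fin (t + 1)) (Fin (t + 1)) ℚ) := by
    rw [pow_two]
    nth_rewrite 1 [hK]
    rw [← Matrix.mul_assoc, hKQD, Matrix.smul_mul, Matrix.mul_nonsing_inv _ hAu]
  refine ⟨hsq, ?_⟩
  have hcard : (Fintype.card R : ℚ) ≠ 0 := by simp
  have hQB : Q * (D * A⁻¹ * (Q * D * A⁻¹)) =
      (Fintype.card R : ℚ) • (1 : Matrix (Fin (t + 1)) (Fin (t + 1)) ℚ) := by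
    rw [← hsq, pow_two]
    simp only [Matrix.mul_assoc]
  refine (Matrix.isUnit_iff_isUnit_det Q).2 (Matrix.isUnit_det_of_right_inverse
    (B := (Fintype.card R : ℚ)⁻¹ • (D * A⁻¹ * (Q * D * A⁻¹))) ?_)
  rw [Matrix.mul_smul, hQB, smul_smul, inv_mul_cancel₀ hcard, one_smul]

end
end

section
/- Let C be a linear code of length n over a finite commutative principal ideal ring R and let λ be a positive integer. Let A be the (t+1)×(t+1) 0–1 matrix with A_{ij} = 1 iff a_iR ⊆ a_jR, D = diag(|a_0R|, …, |a_tR|), and Q the 0–1 matrix with Q_{ij} = 1 iff a_jR ⊆ (a_iR)⊥ = {r ∈ R : a_i r = 0}. Then sse^[λ]_{C⊥}(X) = (1/|C|^λ) · sse^[λ]_C(Q D^λ A^{−1} X), as an identity of polynomials in the variables x_{iℓ}. Consequently, (Q D^λ A^{−1})² = |R|^λ · I, where I is the (t+1)×(t+1) identity matrix. -/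
noncomputable section
open scoped BigOperators

open MvPolynomial Classical

/-- `A^[λ]_C(X)`: the number of `λ`-tuples `(c₁, …, c_λ) ∈ C^λ` such that
`S^[λ]_i(c₁, …, c_λ) = M_i(X)` for all `i`, where
`S^[λ]_i(c₁, …, c_λ) = {ℓ : c_{1ℓ}R + ⋯ + c_{λℓ}R = a_i R}` and the submultiset
`X ⊆ t·[n]` is identified with its multiplicity function `m`. -/
def AL {R : Type*} [CommRing R] {t n : ℕ} (a : Fin (t + 1) → R)
    (C : Submodule R (Fin n → R)) (lam : ℕ) (m : Fin n → Fin (t + 1)) : ℕ :=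
  Nat.card {cs : Fin lam → C // ∀ (i : Fin (t + 1)) (ℓ : Fin n),
    m ℓ = i ↔
      Ideal.span (Set.range fun k => (cs k : Fin n → R) ℓ) = Ideal.span {a i}}

/-- The `λ`-tuple symmetrized support enumerator
`sse^[λ]_C = ∑_{X ⊆ t·[n]} A^[λ]_C(X) ∏ᵢ ∏_{ℓ ∈ M_i(X)} x_{iℓ}`. -/
def sseL {R : Type*} [CommRing R] [Fintype R] {t n : ℕ} (a : Fin (t + 1) → R)
    (C : Submodule R (Fin n → R)) (lam : ℕ) :
    MvPolynomial (Fin (t + 1) × Fin n) ℚ :=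
  ∑ m : Fin n → Fin (t + 1),
    MvPolynomial.C ((AL a C lam m : ℚ)) * ∏ ℓ : Fin n, X (m ℓ, ℓ)

section Duality

variable {R : Type*} [CommRing R]

/-- The annihilator `{r | a * r = 0}` of an element, as an ideal. -/
def annIdeal (a : R) : Ideal R := LinearMap.ker (LinearMap.toSpanSingleton R R a)

theorem mem_annIdeal {a r : R} : r ∈ annIdeal a ↔ a * r = 0 := by
  simp [annIdeal, mul_comm]

theorem card_annIdeal_mul_card_span [Finite R] (a : R) :
    Nat.card (annIdeal a) * Nat.card (Ideal.span {a}) = Nat.card R := by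
  have h := Submodule.card_eq_card_quotient_mul_card (annIdeal a)
  have e := (LinearMap.toSpanSingleton R R a).quotKerEquivRange
  rw [LinearMap.range_toSpanSingleton] at e
  rw [h, ← Nat.card_congr e.toEquiv]
  rfl

theorem card_le_card_ker_mul_card {M N : Type*} [AddCommGroup M] [AddCommGroup N]
    [Module R M] [Module R N] [Finite N] (f : M →ₗ[R] N) :
    Nat.card M ≤ Nat.card (LinearMap.ker f) * Nat.card N := by
  rw [Submodule.card_eq_card_quotient_mul_card (LinearMap.ker f),
    Nat.card_congr f.quotKerEquivRange.toEquiv]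
  exact Nat.mul_le_mul_left _
    (Nat.card_le_card_of_injective (LinearMap.range f).subtype Subtype.val_injective)

theorem annIdeal_eq_span_symm [Finite R] {a b : R} (h : annIdeal a = Ideal.span {b}) :
    annIdeal b = Ideal.span {a} := by
  have hab : a * b = 0 := mem_annIdeal.1 (h ▸ Ideal.mem_span_singleton_self b)
  have hle : Ideal.span {a} ≤ annIdeal b := by
    rw [Ideal.span_singleton_le_iff_mem, mem_annIdeal, mul_comm, hab]
  have h1 := card_annIdeal_mul_card_span a
  have h2 := card_annIdeal_mul_card_span b
  have hcard : Nat.card (annIdeal b) = Nat.card (Ideal.span {a}) := by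
    rw [h] at h1
    exact Nat.eq_of_mul_eq_mul_right (Nat.card_pos (α := Ideal.span {b}))
      (h2.trans (h1.symm.trans (mul_comm _ _)))
  exact (SetLike.coe_injective (Set.eq_of_subset_of_ncard_le hle hcard.le (Set.toFinite _))).symm

theorem card_sup_mul_card_inf {M : Type*} [AddCommGroup M] [Module R M]
    (p q : Submodule R M) :
    Nat.card (p ⊔ q : Submodule R M) * Nat.card (p ⊓ q : Submodule R M) =
      Nat.card p * Nat.card q := by
  have e : q.comap p.subtype ≃ (p ⊓ q : Submodule R M) :=
    { toFun := fun x => ⟨x.1.1, x.1.2, x.2⟩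
      invFun := fun x => ⟨⟨x.1, x.2.1⟩, x.2.2⟩
      left_inv := fun _ => rfl
      right_inv := fun _ => rfl }
  have h1 := Submodule.card_eq_card_quotient_mul_card
    (p.comap p.subtype ⊓ q.comap p.subtype)
  have h2 := Submodule.card_eq_card_quotient_mul_card (q.comap (p ⊔ q).subtype)
  rw [Nat.card_congr (LinearMap.quotientInfEquivSupQuotient p q).toEquiv,
    Submodule.comap_subtype_self, top_inf_eq,
    Nat.card_congr e] at h1
  rw [Nat.card_congr (Submodule.comapSubtypeEquivOfLe (le_sup_right : q ≤ p ⊔ q)).toEquiv] at h2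
  rw [h1, h2]
  ring

theorem dualCode_sup {n : ℕ} (C E : Submodule R (Fin n → R)) :
    dualCode (C ⊔ E) = dualCode C ⊓ dualCode E := by
  ext v
  constructor
  · exact fun h => ⟨fun u hu => h u (Submodule.mem_sup_left hu),
      fun u hu => h u (Submodule.mem_sup_right hu)⟩
  · rintro ⟨h1, h2⟩ u hu
    obtain ⟨y, hy, z, hz, rfl⟩ := Submodule.mem_sup.1 hu
    simp only [Pi.add_apply, add_mul, Finset.sum_add_distrib, h1 y hy, h2 z hz, add_zero]

theorem dualCode_pi_span {n : ℕ} (b : Fin n → R) :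
    dualCode (Submodule.pi Set.univ fun ℓ => Ideal.span {b ℓ}) =
      Submodule.pi Set.univ fun ℓ => annIdeal (b ℓ) := by
  ext v
  rw [Submodule.mem_pi]
  constructor
  · intro h ℓ _
    have := h (Pi.single ℓ (b ℓ)) (by
      rw [Submodule.mem_pi]
      intro k _
      rcases eq_or_ne k ℓ with rfl | hk
      · simp
      · simp [hk])
    rw [mem_annIdeal]
    simpa [Pi.single_apply] using this
  · intro h u hu
    refine Finset.sum_eq_zero fun ℓ _ => ?_
    obtain ⟨r, hr⟩ := Ideal.mem_span_singleton'.1 (Submodule.mem_pi.1 hu ℓ trivial)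
    rw [← hr, mul_assoc, mem_annIdeal.1 (h ℓ trivial), mul_zero]

theorem card_pi_ideal {n : ℕ} (J : Fin n → Ideal R) :
    Nat.card (Submodule.pi Set.univ J : Submodule R (Fin n → R)) = ∏ ℓ, Nat.card (J ℓ) := by
  rw [← Nat.card_pi]
  exact Nat.card_congr
    { toFun := fun x ℓ => ⟨x.1 ℓ, Submodule.mem_pi.1 x.2 ℓ trivial⟩
      invFun := fun x => ⟨fun ℓ => (x ℓ).1, Submodule.mem_pi.2 fun ℓ _ => (x ℓ).2⟩
      left_inv := fun _ => rfl
      right_inv := fun _ => rfl }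

variable [Finite R] [IsPrincipalIdealRing R]

theorem card_dual_span_singleton_le {M : Type*} [AddCommGroup M] [Module R M] (x : M) :
    Nat.card (Submodule.span R {x} →ₗ[R] R) ≤ Nat.card (Submodule.span R {x}) := by
  obtain ⟨p, hp⟩ := (IsPrincipalIdealRing.principal
    (LinearMap.ker (LinearMap.toSpanSingleton R M x))).principal
  have e := (LinearMap.toSpanSingleton R M x).quotKerEquivRange
  rw [LinearMap.range_toSpanSingleton, hp] at e
  have h1 := Submodule.card_eq_card_quotient_mul_card (Submodule.span R {p})
  rw [Nat.card_congr e.toEquiv] at h1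
  have h2 := card_annIdeal_mul_card_span p
  have h3 : Nat.card (annIdeal p) = Nat.card (Submodule.span R {x}) :=
    Nat.eq_of_mul_eq_mul_right (Nat.card_pos (α := Ideal.span {p}))
      (h2.trans (h1.trans (mul_comm _ _)))
  have hpx : p • x = 0 := by
    have : p ∈ LinearMap.ker (LinearMap.toSpanSingleton R M x) :=
      hp ▸ Submodule.mem_span_singleton_self p
    simpa using this
  let x' : Submodule.span R {x} := ⟨x, Submodule.mem_span_singleton_self x⟩
  rw [← h3]
  refine Nat.card_le_card_of_injective
    (fun f => (⟨f x', mem_annIdeal.2 ?_⟩ : annIdeal p)) ?_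
  · have : p • x' = 0 := Subtype.ext hpx
    rw [← smul_eq_mul, ← map_smul, this, map_zero]
  · intro f g hfg
    have hfg : f x' = g x' := congrArg Subtype.val hfg
    ext ⟨y, hy⟩
    obtain ⟨r, rfl⟩ := Submodule.mem_span_singleton.1 hy
    have : (⟨r • x, hy⟩ : Submodule.span R {x}) = r • x' := rfl
    rw [this, map_smul, map_smul, hfg]

theorem card_dual_le (M : Type*) [AddCommGroup M] [Module R M] [Finite M] :
    Nat.card (M →ₗ[R] R) ≤ Nat.card M := by
  induction hc : Nat.card M using Nat.strong_induction_on generalizing M with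
  | _ c ih =>
  subst hc
  rcases subsingleton_or_nontrivial M with hM | hM
  · have : Subsingleton (M →ₗ[R] R) := ⟨fun f g => by ext x; simp [Subsingleton.elim x 0]⟩
    rw [Nat.card_of_subsingleton (0 : M →ₗ[R] R), Nat.card_of_subsingleton (0 : M)]
  obtain ⟨x, hx⟩ := exists_ne (0 : M)
  set N := Submodule.span R {x} with hN
  have hM := Submodule.card_eq_card_quotient_mul_card N
  have : Finite (M ⧸ N) := Finite.of_surjective _ N.mkQ_surjective
  have hN1 : 1 < Nat.card N := by
    have : Nontrivial N := ⟨⟨x, Submodule.mem_span_singleton_self x⟩, 0, fun h =>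
      hx (congrArg Subtype.val h)⟩
    exact Finite.one_lt_card
  have hpos : 0 < Nat.card (M ⧸ N) := Nat.card_pos
  have hlt : Nat.card (M ⧸ N) < Nat.card M := by rw [hM]; nlinarith
  have hq := ih _ hlt (M ⧸ N) rfl
  have : Finite (N →ₗ[R] R) := Finite.of_injective _ DFunLike.coe_injective
  have : Finite ((M ⧸ N) →ₗ[R] R) := Finite.of_injective _ DFunLike.coe_injective
  have hr := card_le_card_ker_mul_card (LinearMap.lcomp R R N.subtype : (M →ₗ[R] R) →ₗ[R] _)
  have hk : Nat.card (LinearMap.ker (LinearMap.lcomp R R N.subtype : (M →ₗ[R] R) →ₗ[R] _))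
      ≤ Nat.card ((M ⧸ N) →ₗ[R] R) := by
    refine Nat.card_le_card_of_injective (fun f => N.liftQ f.1 ?_) ?_
    · intro y hy
      exact LinearMap.congr_fun (LinearMap.mem_ker.1 f.2) ⟨y, hy⟩
    · intro f g hfg
      apply Subtype.ext
      ext y
      exact LinearMap.congr_fun hfg (N.mkQ y)
  calc _ ≤ _ := hr
    _ ≤ Nat.card (M ⧸ N) * Nat.card N :=
      Nat.mul_le_mul (hk.trans hq) (card_dual_span_singleton_le x)
    _ = _ := (mul_comm _ _).trans hM.symm

theorem card_mul_card_dualCode {n : ℕ} (C : Submodule R (Fin n → R)) :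
    Nat.card C * Nat.card (dualCode C) = Nat.card R ^ n := by
  have hn : Nat.card (Fin n → R) = Nat.card R ^ n := by simp [Nat.card_fun]
  let B : (Fin n → R) →ₗ[R] (Fin n → R) →ₗ[R] R := dotProductBilin R R
  have hB : ∀ u v, B u v = ∑ ℓ, u ℓ * v ℓ := fun u v => rfl
  have : Finite (C →ₗ[R] R) := Finite.of_injective _ DFunLike.coe_injective
  have : Finite ((Fin n → R) ⧸ C) := Finite.of_surjective _ C.mkQ_surjective
  have : Finite (((Fin n → R) ⧸ C) →ₗ[R] R) := Finite.of_injective _ DFunLike.coe_injective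
  apply le_antisymm
  · have h := Submodule.card_eq_card_quotient_mul_card C
    rw [← hn, h]
    refine Nat.mul_le_mul_left _ (le_trans ?_ (card_dual_le (R := R) ((Fin n → R) ⧸ C)))
    refine Nat.card_le_card_of_injective (fun v => C.liftQ (B v.1) ?_) ?_
    · intro u hu
      simpa [hB, mul_comm] using v.2 u hu
    · intro v w hvw
      apply Subtype.ext
      funext i
      have := LinearMap.congr_fun hvw (C.mkQ (Pi.single i 1))
      simpa [hB, Pi.single_apply] using this
  · let f : (Fin n → R) →ₗ[R] (C →ₗ[R] R) := (LinearMap.lcomp R R C.subtype).comp B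
    have hker : LinearMap.ker f = dualCode C := by
      ext v
      rw [LinearMap.mem_ker]
      constructor
      · intro h u hu
        have := LinearMap.congr_fun h ⟨u, hu⟩
        simpa [f, hB, mul_comm] using this
      · intro h
        ext u
        have := h u.1 u.2
        simpa [f, hB, mul_comm] using this
    have h := card_le_card_ker_mul_card f
    rw [hker] at h
    rw [← hn, mul_comm]
    exact h.trans (Nat.mul_le_mul_left _ (card_dual_le C))

/-- The shortened-code form of the MacWilliams identities. -/
theorem card_dualCode_inf_pi_mul_card {n : ℕ} (C : Submodule R (Fin n → R)) (b d : Fin n → R)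
    (h : ∀ ℓ, annIdeal (b ℓ) = Ideal.span {d ℓ}) :
    Nat.card (dualCode C ⊓ Submodule.pi Set.univ fun ℓ => Ideal.span {d ℓ} :
        Submodule R (Fin n → R)) * Nat.card C =
      (∏ ℓ, Nat.card (Ideal.span {d ℓ})) *
        Nat.card (C ⊓ Submodule.pi Set.univ fun ℓ => Ideal.span {b ℓ} :
          Submodule R (Fin n → R)) := by
  set P : Submodule R (Fin n → R) := Submodule.pi Set.univ fun ℓ => Ideal.span {b ℓ}
  have hP : dualCode P = Submodule.pi Set.univ fun ℓ => Ideal.span {d ℓ} := by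
    rw [dualCode_pi_span]
    simp only [h]
  rw [← card_pi_ideal, ← hP, ← dualCode_sup]
  have h1 := card_mul_card_dualCode P
  have h2 := card_mul_card_dualCode (C ⊔ P)
  have h3 := card_sup_mul_card_inf C P
  refine Nat.eq_of_mul_eq_mul_right (Nat.card_pos (α := P)) ?_
  calc _ = Nat.card (dualCode (C ⊔ P)) * (Nat.card C * Nat.card P) := by ring
    _ = (Nat.card (C ⊔ P : Submodule R (Fin n → R)) * Nat.card (dualCode (C ⊔ P))) *
        Nat.card (C ⊓ P : Submodule R (Fin n → R)) := by rw [← h3]; ring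
    _ = _ := by rw [h2, ← h1]; ring

end Duality

section Substitution

variable {κ ν : Type*} [Fintype κ]

/-- The substitution `X ↦ B X` on the columns of a matrix of variables. -/
def colSubst (B : Matrix κ κ ℚ) : MvPolynomial (κ × ν) ℚ →ₐ[ℚ] MvPolynomial (κ × ν) ℚ :=
  MvPolynomial.bind₁ fun p => ∑ j, MvPolynomial.C (B p.1 j) * X (j, p.2)

theorem colSubst_X (B : Matrix κ κ ℚ) (i : κ) (ℓ : ν) :
    colSubst B (X (i, ℓ)) = ∑ j, MvPolynomial.C (B i j) * X (j, ℓ) := by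
  simp [colSubst]

theorem colSubst_one [DecidableEq κ] (p : MvPolynomial (κ × ν) ℚ) : colSubst 1 p = p := by
  have : colSubst (1 : Matrix κ κ ℚ) = AlgHom.id ℚ (MvPolynomial (κ × ν) ℚ) := by
    refine MvPolynomial.algHom_ext fun ⟨i, ℓ⟩ => ?_
    rw [colSubst_X, Finset.sum_eq_single i]
    · simp
    · intro j _ hj
      simp [Matrix.one_apply_ne hj.symm]
    · simp
  rw [this, AlgHom.id_apply]

theorem colSubst_colSubst (B B' : Matrix κ κ ℚ) (p : MvPolynomial (κ × ν) ℚ) :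
    colSubst B' (colSubst B p) = colSubst (B * B') p := by
  rw [← AlgHom.comp_apply]
  congr 1
  refine MvPolynomial.algHom_ext fun ⟨i, ℓ⟩ => ?_
  simp only [AlgHom.comp_apply, colSubst_X, map_sum, map_mul, MvPolynomial.algHom_C,
    MvPolynomial.algebraMap_eq, Matrix.mul_apply, Finset.sum_mul, Finset.mul_sum]
  rw [Finset.sum_comm]
  simp only [mul_assoc]

theorem colSubst_prod_X [DecidableEq κ] [Fintype ν] [DecidableEq ν] (B : Matrix κ κ ℚ) (m : ν → κ) :
    colSubst B (∏ ℓ, X (m ℓ, ℓ)) =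
      ∑ J : ν → κ, MvPolynomial.C (∏ ℓ, B (m ℓ) (J ℓ)) * ∏ ℓ, X (J ℓ, ℓ) := by
  rw [map_prod]
  simp only [colSubst_X, Finset.prod_univ_sum, Fintype.piFinset_univ, Finset.prod_mul_distrib,
    map_prod]

end Substitution

section Enumerator

variable {R : Type*} [CommRing R] [Fintype R] {t n : ℕ} {a : Fin (t + 1) → R}

/-- The ideal generated by the `ℓ`-th coordinates of a tuple of codewords. -/
abbrev coordIdeal {C : Submodule R (Fin n → R)} {lam : ℕ} (cs : Fin lam → C) (ℓ : Fin n) :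
    Ideal R :=
  Ideal.span (Set.range fun k => (cs k : Fin n → R) ℓ)

theorem colSubst_sseL (idx : Ideal R → Fin (t + 1))
    (hidx : ∀ I i, idx I = i ↔ I = Ideal.span {a i}) (C : Submodule R (Fin n → R)) (lam : ℕ)
    (B : Matrix (Fin (t + 1)) (Fin (t + 1)) ℚ) :
    colSubst B (sseL a C lam) = ∑ J : Fin n → Fin (t + 1),
      MvPolynomial.C (∑ cs : Fin lam → C, ∏ ℓ, B (idx (coordIdeal cs ℓ)) (J ℓ)) *
        ∏ ℓ, X (J ℓ, ℓ) := by
  have hsse : sseL a C lam = ∑ cs : Fin lam → C, ∏ ℓ, X (idx (coordIdeal cs ℓ), ℓ) := by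
    rw [← Finset.sum_fiberwise Finset.univ
      (fun (cs : Fin lam → C) (ℓ : Fin n) => idx (coordIdeal cs ℓ))]
    refine Finset.sum_congr rfl fun m _ => ?_
    have hconst : ∀ cs ∈ Finset.univ.filter
        (fun cs : Fin lam → C => (fun ℓ => idx (coordIdeal cs ℓ)) = m),
        ∏ ℓ, (X (idx (coordIdeal cs ℓ), ℓ) : MvPolynomial (Fin (t + 1) × Fin n) ℚ) =
          ∏ ℓ, X (m ℓ, ℓ) := by
      intro cs hcs
      rw [← (Finset.mem_filter.1 hcs).2]
    rw [Finset.sum_congr rfl hconst, Finset.sum_const, nsmul_eq_mul]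
    congr 1
    rw [AL, ← Fintype.card_subtype, Nat.card_eq_fintype_card, map_natCast]
    congr 1
    refine Fintype.card_congr (Equiv.subtypeEquivRight fun cs => ?_)
    simp only [← hidx, funext_iff]
    exact ⟨fun h ℓ => (h _ ℓ).1 rfl, fun h i ℓ => by rw [h ℓ]⟩
  simp only [hsse, map_sum, colSubst_prod_X, Finset.sum_mul]
  exact Finset.sum_comm

theorem card_tuples_le {C : Submodule R (Fin n → R)} (lam : ℕ) (J : Fin n → Ideal R) :
    (∑ cs : Fin lam → C, ∏ ℓ, if coordIdeal cs ℓ ≤ J ℓ then (1 : ℚ) else 0) =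
      (Nat.card (C ⊓ Submodule.pi Set.univ J : Submodule R (Fin n → R)) : ℚ) ^ lam := by
  have hiff : ∀ cs : Fin lam → C, (∀ ℓ ∈ Finset.univ, coordIdeal cs ℓ ≤ J ℓ) ↔
      ∀ k, (cs k : Fin n → R) ∈ Submodule.pi Set.univ J := by
    intro cs
    simp only [coordIdeal, Ideal.span_le, Set.range_subset_iff, Submodule.mem_pi, Set.mem_univ,
      Finset.mem_univ, true_imp_iff, SetLike.mem_coe]
    exact forall_comm
  simp only [Finset.prod_ite_zero, Finset.prod_const_one, hiff]
  rw [Finset.sum_boole, ← Fintype.card_subtype, ← Nat.card_eq_fintype_card, ← Nat.cast_pow]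
  congr 1
  rw [← Nat.card_fin lam, ← Nat.card_fun, Nat.card_fin]
  exact Nat.card_congr
    { toFun := fun cs k => ⟨cs.1 k, (cs.1 k).2, cs.2 k⟩
      invFun := fun cs => ⟨fun k => ⟨(cs k).1, (cs k).2.1⟩, fun k => (cs k).2.2⟩
      left_inv := fun _ => rfl
      right_inv := fun _ => rfl }

end Enumerator

section Matrices

theorem isUnit_of_partialOrder {κ : Type*} [Fintype κ] [DecidableEq κ] {α : Type*}
    [PartialOrder α] {f : κ → α} (hf : Function.Injective f) {A : Matrix κ κ ℚ}
    (hA : ∀ i j, A i j = if f i ≤ f j then 1 else 0) : IsUnit A.det := by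
  rw [isUnit_iff_ne_zero]
  intro hdet
  obtain ⟨v, hv, hAv⟩ := Matrix.exists_mulVec_eq_zero_iff.2 hdet
  obtain ⟨i₀, hi₀⟩ := Function.ne_iff.1 hv
  obtain ⟨i, hi, hmax⟩ := Finset.exists_maximalFor f
    (Finset.univ.filter fun i => v i ≠ 0) ⟨i₀, by simpa using hi₀⟩
  have h := congrFun hAv i
  rw [Matrix.mulVec, dotProduct, Finset.sum_eq_single i] at h
  · simp [hA] at h
    simp [h] at hi
  · intro j _ hj
    rw [hA]
    split_ifs with hij
    · by_contra hne
      refine hj (hf (le_antisymm (hmax (by simpa using hne) hij) hij))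
    · simp
  · simp

end Matrices

/-- over a finite commutative principal ideal ring,
`sse^[λ]_{C⊥}(X) = (1/|C|^λ) · sse^[λ]_C(Q D^λ A⁻¹ X)`; consequently
`(Q D^λ A⁻¹)² = |R|^λ · I`. -/
theorem stmt17 {R : Type*} [CommRing R] [Fintype R] [IsPrincipalIdealRing R]
    {t : ℕ} (a : Fin (t + 1) → R)
    (hrep : ∀ r : R, ∃ i, Ideal.span {r} = Ideal.span {a i})
    (hinj : ∀ i j, Ideal.span {a i} = Ideal.span {a j} → i = j)
    {n : ℕ} (C : Submodule R (Fin n → R))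
    (A D Q : Matrix (Fin (t + 1)) (Fin (t + 1)) ℚ)
    (hA : ∀ i j, A i j = if Ideal.span {a i} ≤ Ideal.span {a j} then 1 else 0)
    (hD : D = Matrix.diagonal fun i => (Nat.card (Ideal.span {a i}) : ℚ))
    (hQ : ∀ i j, Q i j =
      if ∀ r ∈ Ideal.span {a j}, a i * r = 0 then 1 else 0)
    (lam : ℕ) (hlam : 0 < lam) :
    sseL a (dualCode C) lam =
      MvPolynomial.C (((Nat.card C : ℚ) ^ lam)⁻¹) *
        (MvPolynomial.bind₁ (fun p : Fin (t + 1) × Fin n =>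
          ∑ j : Fin (t + 1), MvPolynomial.C ((Q * D ^ lam * A⁻¹) p.1 j) * X (j, p.2)))
          (sseL a C lam) ∧
    (Q * D ^ lam * A⁻¹) ^ 2 =
      ((Fintype.card R : ℚ) ^ lam) • (1 : Matrix (Fin (t + 1)) (Fin (t + 1)) ℚ) := by
  have hex : ∀ I : Ideal R, ∃ i, I = Ideal.span {a i} := by
    intro I
    obtain ⟨r, rfl⟩ := (IsPrincipalIdealRing.principal I).principal
    exact hrep r
  choose idx hspan using hex
  have hidx : ∀ I i, idx I = i ↔ I = Ideal.span {a i} := fun I i =>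
    ⟨fun h => h ▸ hspan I, fun h => hinj _ _ ((hspan I).symm.trans h)⟩
  set σ : Fin (t + 1) → Fin (t + 1) := fun j => idx (annIdeal (a j)) with hσ
  have hann : ∀ j, annIdeal (a j) = Ideal.span {a (σ j)} := fun j => hspan _
  have hann' : ∀ j, annIdeal (a (σ j)) = Ideal.span {a j} := fun j =>
    annIdeal_eq_span_symm (hann j)
  have hσσ : ∀ j, σ (σ j) = j := fun j => (hidx _ _).2 (hann' j)
  have hQA : ∀ i j, Q i j = A i (σ j) := by
    intro i j
    rw [hQ, hA, ← hann]
    refine if_congr ?_ rfl rfl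
    rw [Ideal.span_singleton_le_iff_mem, mem_annIdeal]
    constructor
    · intro h
      rw [mul_comm, h _ (Ideal.mem_span_singleton_self _)]
    · intro h r hr
      obtain ⟨s, rfl⟩ := Ideal.mem_span_singleton'.1 hr
      rw [mul_left_comm, mul_comm (a i), h, mul_zero]
  have hdet : IsUnit A.det := isUnit_of_partialOrder (f := fun i => Ideal.span {a i})
    (fun i j h => hinj i j h) hA
  have hDpow : D ^ lam = Matrix.diagonal fun i => (Nat.card (Ideal.span {a i}) : ℚ) ^ lam := by
    rw [hD, Matrix.diagonal_pow]
    rfl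
  constructor
  · have hC : (Nat.card C : ℚ) ≠ 0 := by exact_mod_cast (Nat.card_pos (α := C)).ne'
    have key : colSubst A (sseL a (dualCode C) lam) =
        MvPolynomial.C (((Nat.card C : ℚ) ^ lam)⁻¹) *
          colSubst (Q * D ^ lam) (sseL a C lam) := by
      rw [colSubst_sseL idx hidx, colSubst_sseL idx hidx, Finset.mul_sum]
      refine Finset.sum_congr rfl fun J _ => ?_
      rw [← mul_assoc, ← map_mul]
      congr 2
      have e1 : ∀ i j, A (idx i) j = if i ≤ Ideal.span {a j} then 1 else 0 := fun i j => by
        rw [hA, ← hspan]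
      simp only [hDpow, Matrix.mul_diagonal, hQA, e1, Finset.prod_mul_distrib, ← Finset.sum_mul]
      rw [card_tuples_le lam fun ℓ => Ideal.span {a (J ℓ)},
        card_tuples_le lam fun ℓ => Ideal.span {a (σ (J ℓ))}, Finset.prod_pow, ← mul_pow,
        ← inv_pow, ← mul_pow]
      congr 1
      rw [eq_inv_mul_iff_mul_eq₀ hC]
      have := card_dualCode_inf_pi_mul_card C (fun ℓ => a (σ (J ℓ))) (fun ℓ => a (J ℓ))
        fun ℓ => hann' (J ℓ)
      rw [mul_comm, mul_comm _ (∏ ℓ, _)]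
      exact_mod_cast this
    have := congrArg (colSubst A⁻¹) key
    rw [colSubst_colSubst, Matrix.mul_nonsing_inv _ hdet, colSubst_one, map_mul,
      colSubst_colSubst, MvPolynomial.algHom_C] at this
    exact this
  · set P : Matrix (Fin (t + 1)) (Fin (t + 1)) ℚ :=
      Matrix.of fun k j => if k = σ j then 1 else 0 with hP
    have hQP : Q = A * P := by
      ext i j
      simp [hP, Matrix.mul_apply, hQA]
    have hPP : P * P = 1 := by
      ext i j
      simp [hP, Matrix.mul_apply, hσσ, Matrix.one_apply]
    have hDPD : D ^ lam * P * D ^ lam = ((Fintype.card R : ℚ) ^ lam) • P := by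
      ext i j
      rw [hDpow, Matrix.mul_diagonal, Matrix.diagonal_mul, Matrix.smul_apply]
      simp only [hP, Matrix.of_apply, smul_eq_mul]
      split_ifs with h
      · have hc := card_annIdeal_mul_card_span (a j)
        rw [hann, Nat.card_eq_fintype_card (α := R)] at hc
        rw [h, mul_one, mul_one, ← mul_pow, ← hc, Nat.cast_mul]
      · simp
    calc (Q * D ^ lam * A⁻¹) ^ 2
        = Q * D ^ lam * (A⁻¹ * A) * P * D ^ lam * A⁻¹ := by
          rw [pow_two]
          nth_rewrite 2 [hQP]
          simp only [Matrix.mul_assoc]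
      _ = Q * (D ^ lam * P * D ^ lam) * A⁻¹ := by
          rw [Matrix.nonsing_inv_mul _ hdet]
          simp only [Matrix.mul_assoc, Matrix.one_mul]
      _ = ((Fintype.card R : ℚ) ^ lam) • (A * (P * P) * A⁻¹) := by
          rw [hDPD, hQP]
          simp only [Matrix.mul_assoc, Matrix.mul_smul, Matrix.smul_mul]
      _ = _ := by rw [hPP, Matrix.mul_one, Matrix.mul_nonsing_inv _ hdet]

end
end

section
/- Let R be a finite commutative chain ring with maximal ideal γR, nilpotency index ν and residue field size q = |R/γR|, with representatives a_i = γ^{ν−i} for i = 0, …, ν (so t = ν). Let C be a linear code of length n over R and let λ be a positive integer. Then sse^[λ]_{C⊥}(X) = (1/|C|^λ) · sse^[λ]_C(S^[λ] X), where S^[λ] = Q D^λ A^{−1} is the (ν+1)×(ν+1) matrix with entries (rows and columns indexed by {0,…,ν}): s_{i0} = 1 for all i; s_{ij} = q^{jλ} − q^{(j−1)λ} if 1 ≤ j ≤ ν − i; s_{ij} = −q^{(ν−i)λ} if j = ν + 1 − i; and s_{ij} = 0 otherwise. -/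
noncomputable section
open scoped BigOperators

open MvPolynomial Classical

section ChainRing

variable {R : Type*} [CommRing R] [IsLocalRing R] {γ : R} {ν : ℕ}

theorem pow_ne_zero_of_lt_nilpotencyIndex
    (hmin : ∀ m : ℕ, 0 < m → γ ^ m = 0 → ν ≤ m) {k : ℕ} (hk : k < ν) : γ ^ k ≠ 0 := by
  intro h
  rcases Nat.eq_zero_or_pos k with rfl | hpos
  · simp at h
  · exact absurd (hmin k hpos h) (by omega)

theorem exists_eq_unit_mul_pow (hγ : IsLocalRing.maximalIdeal R = Ideal.span {γ})
    (hγν : γ ^ ν = 0) (x : R) : ∃ u : R, IsUnit u ∧ ∃ k ≤ ν, x = u * γ ^ k := by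
  have key : ∀ j ≤ ν, (∃ u : R, IsUnit u ∧ ∃ k ≤ ν, x = u * γ ^ k) ∨ γ ^ j ∣ x := by
    intro j
    induction j with
    | zero => intro _; right; simp
    | succ j ih =>
      intro hj
      rcases ih (by omega) with h | ⟨y, rfl⟩
      · exact Or.inl h
      · by_cases hy : IsUnit y
        · exact Or.inl ⟨y, hy, j, by omega, mul_comm _ _⟩
        · right
          have : y ∈ IsLocalRing.maximalIdeal R := hy
          rw [hγ, Ideal.mem_span_singleton] at this
          rw [pow_succ]
          exact mul_dvd_mul_left _ this
  rcases key ν le_rfl with h | h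
  · exact h
  · rw [hγν, zero_dvd_iff] at h
    exact ⟨1, isUnit_one, ν, le_rfl, by simp [h, hγν]⟩

theorem pow_eq_zero_iff_nilpotencyIndex_le (hγν : γ ^ ν = 0)
    (hmin : ∀ m : ℕ, 0 < m → γ ^ m = 0 → ν ≤ m) (k : ℕ) : γ ^ k = 0 ↔ ν ≤ k := by
  constructor
  · intro h
    by_contra hlt
    exact pow_ne_zero_of_lt_nilpotencyIndex hmin (not_le.mp hlt) h
  · exact fun h => pow_eq_zero_of_le h hγν

theorem pow_mul_eq_zero_iff_mem_span (hγ : IsLocalRing.maximalIdeal R = Ideal.span {γ})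
    (hγν : γ ^ ν = 0) (hmin : ∀ m : ℕ, 0 < m → γ ^ m = 0 → ν ≤ m) (a : ℕ) (x : R) :
    γ ^ a * x = 0 ↔ x ∈ Ideal.span {γ ^ (ν - a)} := by
  rw [Ideal.mem_span_singleton]
  constructor
  · intro h
    obtain ⟨u, hu, k, -, rfl⟩ := exists_eq_unit_mul_pow hγ hγν x
    have h' : u * γ ^ (a + k) = 0 := by rw [← h, pow_add]; ring
    rw [hu.mul_right_eq_zero, pow_eq_zero_iff_nilpotencyIndex_le hγν hmin] at h'
    exact Dvd.dvd.mul_left (pow_dvd_pow _ (by omega)) _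
  · rintro ⟨y, rfl⟩
    rw [← mul_assoc, ← pow_add, pow_eq_zero_of_le (by omega) hγν, zero_mul]

theorem span_pow_le_span_pow_iff (hγν : γ ^ ν = 0)
    (hmin : ∀ m : ℕ, 0 < m → γ ^ m = 0 → ν ≤ m) {a b : ℕ} (hb : b ≤ ν) :
    Ideal.span {γ ^ a} ≤ Ideal.span {γ ^ b} ↔ b ≤ a := by
  rw [Ideal.span_singleton_le_span_singleton]
  constructor
  · rintro ⟨c, hc⟩
    have h : γ ^ (ν - b + a) = 0 := by
      rw [pow_add, hc, ← mul_assoc, ← pow_add, Nat.sub_add_cancel hb, hγν, zero_mul]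
    rw [pow_eq_zero_iff_nilpotencyIndex_le hγν hmin] at h
    omega
  · exact fun h => pow_dvd_pow _ h

theorem exists_eq_span_pow (hγ : IsLocalRing.maximalIdeal R = Ideal.span {γ})
    (hγν : γ ^ ν = 0) (J : Ideal R) : ∃ k ≤ ν, J = Ideal.span {γ ^ k} := by
  have hex : ∃ k, γ ^ k ∈ J := ⟨ν, by simp [hγν]⟩
  refine ⟨Nat.find hex, Nat.find_min' hex (by simp [hγν]), le_antisymm ?_ ?_⟩
  · intro x hx
    obtain ⟨u, hu, k, -, rfl⟩ := exists_eq_unit_mul_pow hγ hγν x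
    rw [Ideal.mem_span_singleton]
    exact Dvd.dvd.mul_left
      (pow_dvd_pow _ (Nat.find_min' hex ((Ideal.unit_mul_mem_iff_mem J hu).mp hx))) _
  · rw [Ideal.span_singleton_le_iff_mem]
    exact Nat.find_spec hex

theorem AddMonoidHom.card_eq_card_ker_mul_card_range {M N : Type*} [AddGroup M] [AddGroup N]
    (f : M →+ N) : Nat.card M = Nat.card f.ker * Nat.card f.range := by
  rw [← AddSubgroup.index_ker, AddSubgroup.card_mul_index]

theorem card_span_pow [Finite R] (hγ : IsLocalRing.maximalIdeal R = Ideal.span {γ})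
    (hν : 0 < ν) (hγν : γ ^ ν = 0) (hmin : ∀ m : ℕ, 0 < m → γ ^ m = 0 → ν ≤ m)
    {i : ℕ} (hi : i ≤ ν) :
    Nat.card (Ideal.span {γ ^ (ν - i)}) = Nat.card (R ⧸ IsLocalRing.maximalIdeal R) ^ i := by
  have hone : Nat.card (Ideal.span {γ ^ (ν - 1)}) =
      Nat.card (R ⧸ IsLocalRing.maximalIdeal R) := by
    have h1 := (AddMonoidHom.mulLeft (γ ^ (ν - 1))).card_eq_card_ker_mul_card_range
    have hker : Nat.card (AddMonoidHom.mulLeft (γ ^ (ν - 1))).ker =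
        Nat.card (IsLocalRing.maximalIdeal R) := by
      refine Nat.card_congr (Equiv.subtypeEquivRight fun x => ?_)
      rw [AddMonoidHom.mem_ker, AddMonoidHom.coe_mulLeft,
        pow_mul_eq_zero_iff_mem_span hγ hγν hmin, hγ, Nat.sub_sub_self hν, pow_one]
    have hrange : Nat.card (AddMonoidHom.mulLeft (γ ^ (ν - 1))).range =
        Nat.card (Ideal.span {γ ^ (ν - 1)}) := by
      refine Nat.card_congr (Equiv.subtypeEquivRight fun x => ?_)
      rw [Ideal.mem_span_singleton, AddMonoidHom.mem_range]
      exact exists_congr fun y => eq_comm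
    have h2 := Submodule.card_eq_card_quotient_mul_card (IsLocalRing.maximalIdeal R)
    rw [hker, hrange] at h1
    rw [h1] at h2
    exact Nat.eq_of_mul_eq_mul_left Nat.card_pos h2
  induction i with
  | zero => simp [hγν]
  | succ i ih =>
    rw [pow_succ, ← ih (by omega), ← hone]
    set f : Ideal.span {γ ^ (ν - (i + 1))} →+ R :=
      (AddMonoidHom.mulLeft γ).comp (Submodule.subtype _).toAddMonoidHom with hf
    have hfx : ∀ x, f x = γ * (x : R) := fun x => rfl
    rw [f.card_eq_card_ker_mul_card_range, mul_comm]
    congr 1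
    · refine Nat.card_congr (Equiv.subtypeEquivRight fun x => ?_)
      rw [Ideal.mem_span_singleton, AddMonoidHom.mem_range,
        show ν - i = ν - (i + 1) + 1 by omega]
      constructor
      · rintro ⟨⟨y, hy⟩, rfl⟩
        rw [Ideal.mem_span_singleton] at hy
        rw [hfx, pow_succ, mul_comm γ]
        exact mul_dvd_mul_right hy _
      · rintro ⟨y, rfl⟩
        refine ⟨⟨γ ^ (ν - (i + 1)) * y, ?_⟩, ?_⟩
        · exact Ideal.mul_mem_right _ _ (Ideal.mem_span_singleton_self _)
        · rw [hfx]; ring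
    · have hle : Ideal.span {γ ^ (ν - 1)} ≤ Ideal.span {γ ^ (ν - (i + 1))} :=
        (span_pow_le_span_pow_iff hγν hmin (by omega)).mpr (by omega)
      have hiff : ∀ x : R, γ * x = 0 ↔ x ∈ Ideal.span {γ ^ (ν - 1)} := fun x => by
        simpa using pow_mul_eq_zero_iff_mem_span hγ hγν hmin 1 x
      exact Nat.card_congr
        { toFun := fun x => ⟨x.1.1, (hiff _).mp x.2⟩
          invFun := fun x => ⟨⟨x.1, hle x.2⟩, (hiff _).mpr x.2⟩
          left_inv := fun _ => rfl
          right_inv := fun _ => rfl }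

theorem exists_addChar_nontrivial_on_ideals [Finite R]
    (hγ : IsLocalRing.maximalIdeal R = Ideal.span {γ})
    (hν : 0 < ν) (hγν : γ ^ ν = 0) (hmin : ∀ m : ℕ, 0 < m → γ ^ m = 0 → ν ≤ m) :
    ∃ ψ : AddChar R ℂ, ∀ J : Ideal R, J ≠ ⊥ → ∃ x ∈ J, ψ x ≠ 1 := by
  obtain ⟨ψ, hψ⟩ := AddChar.exists_apply_ne_zero.mpr
    (pow_ne_zero_of_lt_nilpotencyIndex hmin (show ν - 1 < ν by omega))
  refine ⟨ψ, fun J hJ => ⟨γ ^ (ν - 1), ?_, hψ⟩⟩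
  obtain ⟨k, hk, rfl⟩ := exists_eq_span_pow hγ hγν J
  have hkν : k ≠ ν := by
    rintro rfl
    exact hJ (by simp [hγν])
  rw [Ideal.mem_span_singleton]
  exact pow_dvd_pow _ (by omega)

end ChainRing

section Duality

variable {R : Type*} [CommRing R] {n : ℕ}

theorem mem_dualCode {C : Submodule R (Fin n → R)} {v : Fin n → R} :
    v ∈ dualCode C ↔ ∀ u ∈ C, ∑ ℓ, u ℓ * v ℓ = 0 := Iff.rfl

theorem sum_addChar_dotProduct [Fintype R] {ψ : AddChar R ℂ}
    (hψ : ∀ J : Ideal R, J ≠ ⊥ → ∃ x ∈ J, ψ x ≠ 1)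
    (C : Submodule R (Fin n → R)) (v : Fin n → R) :
    ∑ u : C, ψ (∑ ℓ, (u : Fin n → R) ℓ * v ℓ) =
      if v ∈ dualCode C then (Nat.card C : ℂ) else 0 := by
  let f : C →ₗ[R] R :=
    { toFun := fun u => ∑ ℓ, (u : Fin n → R) ℓ * v ℓ
      map_add' := fun u w => by simp [add_mul, Finset.sum_add_distrib]
      map_smul' := fun c u => by simp [Finset.mul_sum, mul_assoc] }
  have h := AddChar.sum_eq_ite (ψ.compAddMonoidHom f.toAddMonoidHom)
  have hiff : ψ.compAddMonoidHom f.toAddMonoidHom = 0 ↔ v ∈ dualCode C := by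
    constructor
    · intro h0
      by_contra hv
      have hne : LinearMap.range f ≠ ⊥ := by
        intro hbot
        refine hv fun u hu => ?_
        have : f ⟨u, hu⟩ ∈ LinearMap.range f := ⟨_, rfl⟩
        rwa [hbot, Submodule.mem_bot] at this
      obtain ⟨_, ⟨u, rfl⟩, hu⟩ := hψ _ hne
      exact hu (DFunLike.congr_fun h0 u)
    · intro hv
      ext u
      have : f u = 0 := hv u u.2
      simp [this]
  simp only [hiff] at h
  rw [Nat.card_eq_fintype_card]
  exact h

theorem card_mul_card_dualCode_inf [Fintype R] {ψ : AddChar R ℂ}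
    (hψ : ∀ J : Ideal R, J ≠ ⊥ → ∃ x ∈ J, ψ x ≠ 1) (C E : Submodule R (Fin n → R)) :
    Nat.card C * Nat.card {v : E // (v : Fin n → R) ∈ dualCode C} =
      Nat.card E * Nat.card {u : C // (u : Fin n → R) ∈ dualCode E} := by
  have key : ∀ C E : Submodule R (Fin n → R),
      ∑ v : E, ∑ u : C, ψ (∑ ℓ, (u : Fin n → R) ℓ * (v : Fin n → R) ℓ) =
        (Nat.card C * Nat.card {v : E // (v : Fin n → R) ∈ dualCode C} : ℂ) := by
    intro C E
    simp only [sum_addChar_dotProduct hψ]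
    rw [← Finset.sum_filter, Finset.sum_const, nsmul_eq_mul, mul_comm,
      Nat.card_eq_fintype_card (α := {v : E // (v : Fin n → R) ∈ dualCode C}),
      Fintype.card_subtype]
  have h : (Nat.card C * Nat.card {v : E // (v : Fin n → R) ∈ dualCode C} : ℂ) =
      Nat.card E * Nat.card {u : C // (u : Fin n → R) ∈ dualCode E} := by
    rw [← key C E, ← key E C, Finset.sum_comm]
    exact Finset.sum_congr rfl fun u _ => Finset.sum_congr rfl fun v _ =>
      congrArg ψ (Finset.sum_congr rfl fun ℓ _ => mul_comm _ _)
  exact_mod_cast h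

theorem mem_dualCode_pi {I : Fin n → Ideal R} {v : Fin n → R} :
    v ∈ dualCode (Submodule.pi Set.univ I) ↔ ∀ ℓ, ∀ r ∈ I ℓ, r * v ℓ = 0 := by
  constructor
  · intro h ℓ r hr
    have := h (Pi.single ℓ r) (fun k _ => by
      by_cases hk : k = ℓ
      · subst hk; simpa using hr
      · simp [Pi.single_eq_of_ne hk])
    rwa [Finset.sum_eq_single ℓ (fun k _ hk => by simp [Pi.single_eq_of_ne hk]) (by simp),
      Pi.single_eq_same] at this
  · intro h u hu
    exact Finset.sum_eq_zero fun ℓ _ => h ℓ _ (hu ℓ (Set.mem_univ _))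

theorem card_submodule_pi (I : Fin n → Ideal R) :
    Nat.card (Submodule.pi Set.univ I : Submodule R (Fin n → R)) = ∏ ℓ, Nat.card (I ℓ) := by
  rw [← Nat.card_pi]
  exact Nat.card_congr
    { toFun := fun v ℓ => ⟨v.1 ℓ, v.2 ℓ (Set.mem_univ _)⟩
      invFun := fun w => ⟨fun ℓ => (w ℓ).1, fun ℓ _ => (w ℓ).2⟩
      left_inv := fun _ => rfl
      right_inv := fun _ => rfl }

end Duality

section Enumerator

variable {R : Type*} [CommRing R] [Fintype R] {t n : ℕ}

theorem sseL_eq_sum_tuples {a : Fin (t + 1) → R} {idx : Ideal R → Fin (t + 1)}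
    (hidx : ∀ J i, idx J = i ↔ J = Ideal.span {a i})
    (C : Submodule R (Fin n → R)) (lam : ℕ) :
    sseL a C lam = ∑ cs : Fin lam → C, ∏ ℓ : Fin n,
      X (idx (Ideal.span (Set.range fun k => (cs k : Fin n → R) ℓ)), ℓ) := by
  rw [sseL, ← Finset.sum_fiberwise (g := fun (cs : Fin lam → C) (ℓ : Fin n) =>
    idx (Ideal.span (Set.range fun k => (cs k : Fin n → R) ℓ)))]
  refine Finset.sum_congr rfl fun m _ => ?_
  have hAL : AL a C lam m = (Finset.univ.filter fun cs : Fin lam → C =>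
      (fun ℓ => idx (Ideal.span (Set.range fun k => (cs k : Fin n → R) ℓ))) = m).card := by
    rw [AL, Nat.card_eq_fintype_card, Fintype.card_subtype]
    congr 1
    refine Finset.filter_congr fun cs _ => ?_
    simp only [← hidx, funext_iff]
    constructor
    · exact fun h ℓ => (h (m ℓ) ℓ).mp rfl
    · intro h i ℓ
      rw [h ℓ]
  rw [hAL, Finset.sum_congr rfl fun cs hcs => by
    rw [Finset.prod_congr rfl fun ℓ _ => by
      rw [congrFun (Finset.mem_filter.mp hcs).2 ℓ]]]
  simp

theorem card_tuples_mem (C : Submodule R (Fin n → R)) (lam : ℕ) (I : Fin n → Ideal R) :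
    Nat.card {cs : Fin lam → C // ∀ k ℓ, (cs k : Fin n → R) ℓ ∈ I ℓ} =
      Nat.card {c : C // ∀ ℓ, (c : Fin n → R) ℓ ∈ I ℓ} ^ lam := by
  rw [Nat.card_congr (Equiv.subtypePiEquivPi
    (p := fun (_ : Fin lam) (c : C) => ∀ ℓ, (c : Fin n → R) ℓ ∈ I ℓ)), Nat.card_pi]
  simp

/-- The linear substitution replacing each column of variables by `M` times that column. -/
def columnSubst (M : Matrix (Fin (t + 1)) (Fin (t + 1)) ℚ) :
    MvPolynomial (Fin (t + 1) × Fin n) ℚ →ₐ[ℚ] MvPolynomial (Fin (t + 1) × Fin n) ℚ :=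
  MvPolynomial.bind₁ fun p => ∑ j, MvPolynomial.C (M p.1 j) * X (j, p.2)

theorem columnSubst_columnSubst (M N : Matrix (Fin (t + 1)) (Fin (t + 1)) ℚ)
    (P : MvPolynomial (Fin (t + 1) × Fin n) ℚ) :
    columnSubst N (columnSubst M P) = columnSubst (M * N) P := by
  rw [columnSubst, columnSubst, MvPolynomial.bind₁_bind₁, columnSubst]
  congr 2
  funext p
  simp only [map_sum, map_mul, MvPolynomial.bind₁_C_right, MvPolynomial.bind₁_X_right,
    Matrix.mul_apply, Finset.mul_sum, Finset.sum_mul, mul_assoc]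
  exact Finset.sum_comm

theorem columnSubst_one (P : MvPolynomial (Fin (t + 1) × Fin n) ℚ) :
    columnSubst 1 P = P := by
  have : (fun p : Fin (t + 1) × Fin n => ∑ j, MvPolynomial.C
      ((1 : Matrix (Fin (t + 1)) (Fin (t + 1)) ℚ) p.1 j) * X (j, p.2)) = X (R := ℚ) := by
    funext p
    rw [Finset.sum_eq_single p.1] <;> simp +contextual [eq_comm]
  rw [columnSubst, this, MvPolynomial.bind₁_X_left, AlgHom.id_apply]

theorem columnSubst_sseL {a : Fin (t + 1) → R} {idx : Ideal R → Fin (t + 1)}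
    (hidx : ∀ J i, idx J = i ↔ J = Ideal.span {a i})
    (hle : ∀ i j, Ideal.span {a i} ≤ Ideal.span {a j} ↔ i ≤ j)
    (C : Submodule R (Fin n → R)) (lam : ℕ) (τ : Fin (t + 1) → Fin (t + 1))
    (w : Fin (t + 1) → ℚ) {B : Matrix (Fin (t + 1)) (Fin (t + 1)) ℚ}
    (hB : ∀ i j, B i j = if i ≤ τ j then w j else 0) :
    columnSubst B (sseL a C lam) = ∑ m : Fin n → Fin (t + 1),
      MvPolynomial.C ((∏ ℓ, w (m ℓ)) * (Nat.card {c : C //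
        ∀ ℓ, (c : Fin n → R) ℓ ∈ Ideal.span {a (τ (m ℓ))}} : ℚ) ^ lam) *
      ∏ ℓ, X (m ℓ, ℓ) := by
  have hmem : ∀ (cs : Fin lam → C) (ℓ : Fin n) (j : Fin (t + 1)),
      idx (Ideal.span (Set.range fun k => (cs k : Fin n → R) ℓ)) ≤ j ↔
        ∀ k, (cs k : Fin n → R) ℓ ∈ Ideal.span {a j} := by
    intro cs ℓ j
    rw [← hle, ← (hidx _ _).mp rfl, Ideal.span_le, Set.range_subset_iff]
    rfl
  have hprod : ∀ (cs : Fin lam → C) (m : Fin n → Fin (t + 1)),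
      (∏ ℓ, B (idx (Ideal.span (Set.range fun k => (cs k : Fin n → R) ℓ))) (m ℓ)) =
        if ∀ k ℓ, (cs k : Fin n → R) ℓ ∈ Ideal.span {a (τ (m ℓ))}
        then ∏ ℓ, w (m ℓ) else 0 := by
    intro cs m
    simp only [hB, hmem]
    split_ifs with h
    · exact Finset.prod_congr rfl fun ℓ _ => if_pos fun k => h k ℓ
    · push Not at h
      obtain ⟨k, ℓ, hk⟩ := h
      exact Finset.prod_eq_zero (Finset.mem_univ ℓ) (if_neg fun h => hk (h k))
  rw [sseL_eq_sum_tuples hidx, columnSubst]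
  simp only [map_sum, map_prod, MvPolynomial.bind₁_X_right, Finset.prod_univ_sum,
    Fintype.piFinset_univ, Finset.prod_mul_distrib]
  rw [Finset.sum_comm]
  refine Finset.sum_congr rfl fun m _ => ?_
  rw [← Finset.sum_mul]
  simp only [← map_prod, ← map_sum]
  congr 2
  rw [Finset.sum_congr rfl fun cs _ => hprod cs m, ← Finset.sum_filter, Finset.sum_const,
    nsmul_eq_mul, mul_comm, ← Nat.cast_pow, ← card_tuples_mem C lam fun ℓ =>
      Ideal.span {a (τ (m ℓ))}, Nat.card_eq_fintype_card, Fintype.card_subtype]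

end Enumerator

theorem sum_dualMatrix_row {ν lam : ℕ} {q : ℚ} {S A : Matrix (Fin (ν + 1)) (Fin (ν + 1)) ℚ}
    (hS : ∀ i j : Fin (ν + 1), S i j =
      if (j : ℕ) = 0 then 1
      else if (j : ℕ) ≤ ν - (i : ℕ) then q ^ ((j : ℕ) * lam) - q ^ (((j : ℕ) - 1) * lam)
      else if (j : ℕ) = ν + 1 - (i : ℕ) then -q ^ ((ν - (i : ℕ)) * lam)
      else 0)
    (hA : ∀ i j, A i j = if i ≤ j then 1 else 0) (i j : Fin (ν + 1)) :
    ∑ k, S i k * A k j = if i ≤ Fin.rev j then q ^ ((j : ℕ) * lam) else 0 := by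
  set s : ℕ → ℚ := fun k => if k = 0 then 1
    else if k ≤ ν - (i : ℕ) then q ^ (k * lam) - q ^ ((k - 1) * lam)
    else if k = ν + 1 - (i : ℕ) then -q ^ ((ν - (i : ℕ)) * lam)
    else 0 with hs
  have hsum : ∀ m : ℕ, ∑ k ∈ Finset.range (m + 1), s k =
      if m ≤ ν - (i : ℕ) then q ^ (m * lam) else 0 := by
    intro m
    induction m with
    | zero => simp [hs]
    | succ m ih =>
      rw [Finset.sum_range_succ, ih]
      simp only [hs, Nat.add_eq_zero_iff, one_ne_zero, and_false, if_false,
        Nat.add_sub_cancel]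
      rcases lt_trichotomy m (ν - (i : ℕ)) with h | h | h
      · rw [if_pos (by omega), if_pos (by omega), if_pos (by omega)]
        ring
      · rw [if_pos (by omega), if_neg (by omega), if_pos (by omega), if_neg (by omega), h]
        ring
      · rw [if_neg (by omega), if_neg (by omega), if_neg (by omega), if_neg (by omega), add_zero]
  have hcond : i ≤ Fin.rev j ↔ (j : ℕ) ≤ ν - (i : ℕ) := by
    rw [Fin.le_def, Fin.val_rev]
    omega
  simp only [hcond, ← hsum, hA, hS, mul_ite, mul_one, mul_zero, Fin.le_def]
  rw [Fin.sum_univ_eq_sum_range (fun k => if k ≤ (j : ℕ) then s k else 0), ← Finset.sum_filter]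
  congr 1
  ext k
  simp only [Finset.mem_filter, Finset.mem_range]
  omega

/-- over a finite commutative chain ring with representatives
`a_i = γ^(ν − i)`, the matrix `S^[λ] = Q D^λ A⁻¹` has the stated explicit
entries and `sse^[λ]_{C⊥}(X) = (1/|C|^λ) · sse^[λ]_C(S^[λ] X)`. -/
theorem stmt18 {R : Type*} [CommRing R] [Fintype R] [IsLocalRing R]
    (hchain : ∀ I J : Ideal R, I ≤ J ∨ J ≤ I)
    (γ : R) (hγ : IsLocalRing.maximalIdeal R = Ideal.span {γ})
    (ν : ℕ) (hν : 0 < ν) (hγν : γ ^ ν = 0)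
    (hmin : ∀ m : ℕ, 0 < m → γ ^ m = 0 → ν ≤ m)
    (q : ℕ) (hq : q = Nat.card (R ⧸ IsLocalRing.maximalIdeal R))
    {n : ℕ} (C : Submodule R (Fin n → R))
    (A D Q : Matrix (Fin (ν + 1)) (Fin (ν + 1)) ℚ)
    (hA : ∀ i j : Fin (ν + 1), A i j =
      if Ideal.span {γ ^ (ν - (i : ℕ))} ≤ Ideal.span {γ ^ (ν - (j : ℕ))} then 1 else 0)
    (hD : D = Matrix.diagonal fun i : Fin (ν + 1) =>
      (Nat.card (Ideal.span {γ ^ (ν - (i : ℕ))}) : ℚ))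
    (hQ : ∀ i j : Fin (ν + 1), Q i j =
      if ∀ r ∈ Ideal.span {γ ^ (ν - (j : ℕ))}, γ ^ (ν - (i : ℕ)) * r = 0
      then 1 else 0)
    (lam : ℕ) (hlam : 0 < lam)
    (S : Matrix (Fin (ν + 1)) (Fin (ν + 1)) ℚ)
    (hS : ∀ i j : Fin (ν + 1), S i j =
      if (j : ℕ) = 0 then 1
      else if (j : ℕ) ≤ ν - (i : ℕ) then
        (q : ℚ) ^ ((j : ℕ) * lam) - (q : ℚ) ^ (((j : ℕ) - 1) * lam)
      else if (j : ℕ) = ν + 1 - (i : ℕ) then -(q : ℚ) ^ ((ν - (i : ℕ)) * lam)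
      else 0) :
    S = Q * D ^ lam * A⁻¹ ∧
    sseL (fun i : Fin (ν + 1) => γ ^ (ν - (i : ℕ))) (dualCode C) lam =
      MvPolynomial.C (((Nat.card C : ℚ) ^ lam)⁻¹) *
        (MvPolynomial.bind₁ (fun p : Fin (ν + 1) × Fin n =>
          ∑ j : Fin (ν + 1), MvPolynomial.C (S p.1 j) * X (j, p.2)))
          (sseL (fun i : Fin (ν + 1) => γ ^ (ν - (i : ℕ))) C lam) := by
  have hrep : ∀ J : Ideal R, ∃ i : Fin (ν + 1), J = Ideal.span {γ ^ (ν - (i : ℕ))} := by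
    intro J
    obtain ⟨k, hk, rfl⟩ := exists_eq_span_pow hγ hγν J
    exact ⟨⟨ν - k, by omega⟩, by simp [Nat.sub_sub_self hk]⟩
  have hle : ∀ i j : Fin (ν + 1),
      Ideal.span {γ ^ (ν - (i : ℕ))} ≤ Ideal.span {γ ^ (ν - (j : ℕ))} ↔ i ≤ j := by
    intro i j
    rw [span_pow_le_span_pow_iff hγν hmin (by omega), Fin.le_def]
    omega
  choose idx hidx' using hrep
  have hidx : ∀ J i, idx J = i ↔ J = Ideal.span {γ ^ (ν - (i : ℕ))} := by
    intro J i
    constructor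
    · rintro rfl
      exact hidx' J
    · intro h
      have h' := (hidx' J).symm.trans h
      exact le_antisymm ((hle _ _).mp h'.le) ((hle _ _).mp h'.ge)
  have hcard : ∀ i : Fin (ν + 1), Nat.card (Ideal.span {γ ^ (ν - (i : ℕ))}) = q ^ (i : ℕ) :=
    fun i => by rw [hq]; exact card_span_pow hγ hν hγν hmin (by omega)
  have hann : ∀ (j : Fin (ν + 1)) (x : R),
      (∀ r ∈ Ideal.span {γ ^ (ν - (j : ℕ))}, r * x = 0) ↔
        x ∈ Ideal.span {γ ^ (ν - (Fin.rev j : ℕ))} := by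
    intro j x
    rw [show ν - (Fin.rev j : ℕ) = ν - (ν - (j : ℕ)) by rw [Fin.val_rev]; omega,
      ← pow_mul_eq_zero_iff_mem_span hγ hγν hmin]
    constructor
    · exact fun h => h _ (Ideal.mem_span_singleton_self _)
    · intro h r hr
      obtain ⟨s, rfl⟩ := Ideal.mem_span_singleton.mp hr
      rw [mul_right_comm, h, zero_mul]
  have hA' : ∀ i j, A i j = if i ≤ j then 1 else 0 := fun i j => by simp only [hA, hle]
  have hQ' : ∀ i j, Q i j = if i ≤ Fin.rev j then 1 else 0 := by
    intro i j
    rw [hQ]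
    refine if_congr ?_ rfl rfl
    rw [← hle, Ideal.span_singleton_le_iff_mem, ← hann]
    simp only [mul_comm]
  have hQD : ∀ i j, (Q * D ^ lam) i j = if i ≤ Fin.rev j then (q : ℚ) ^ ((j : ℕ) * lam) else 0 := by
    intro i j
    rw [hD, Matrix.diagonal_pow, Matrix.mul_diagonal, hQ', Pi.pow_apply, hcard, ite_mul,
      one_mul, zero_mul, Nat.cast_pow, ← pow_mul]
  have hdet : A.det = 1 := by
    rw [Matrix.det_of_isUpperTriangular]
    · simp [hA']
    · intro i j hij
      exact (hA' i j).trans (if_neg (not_le.mpr hij))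
  have hAunit : IsUnit A.det := by simp [hdet]
  have hSA : S * A = Q * D ^ lam := by
    ext i j
    rw [hQD, Matrix.mul_apply]
    exact sum_dualMatrix_row hS hA' i j
  refine ⟨by rw [← hSA, Matrix.mul_nonsing_inv_cancel_right _ _ hAunit], ?_⟩
  obtain ⟨ψ, hψ⟩ := exists_addChar_nontrivial_on_ideals hγ hν hγν hmin
  have hCpos : (Nat.card C : ℚ) ≠ 0 := Nat.cast_ne_zero.mpr Nat.card_pos.ne'
  have hA_eq : columnSubst A
      (sseL (fun i : Fin (ν + 1) => γ ^ (ν - (i : ℕ))) (dualCode C) lam) =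
      columnSubst A (MvPolynomial.C (((Nat.card C : ℚ) ^ lam)⁻¹) *
        columnSubst S (sseL (fun i : Fin (ν + 1) => γ ^ (ν - (i : ℕ))) C lam)) := by
    rw [map_mul, columnSubst_columnSubst, hSA, columnSubst_sseL hidx hle _ lam id 1 hA',
      columnSubst_sseL hidx hle _ lam Fin.rev (fun j => (q : ℚ) ^ ((j : ℕ) * lam)) hQD,
      columnSubst, MvPolynomial.bind₁_C_right, Finset.mul_sum]
    refine Finset.sum_congr rfl fun m _ => ?_
    rw [← mul_assoc, ← map_mul]
    congr 2
    have hdual := card_mul_card_dualCode_inf hψ C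
      (Submodule.pi Set.univ fun ℓ => Ideal.span {γ ^ (ν - (m ℓ : ℕ))})
    simp only [card_submodule_pi, hcard, mem_dualCode_pi, hann] at hdual
    have hswap : Nat.card {v : (Submodule.pi Set.univ fun ℓ =>
          Ideal.span {γ ^ (ν - (m ℓ : ℕ))} : Submodule R (Fin n → R)) //
          (v : Fin n → R) ∈ dualCode C} =
        Nat.card {c : dualCode C // ∀ ℓ,
          (c : Fin n → R) ℓ ∈ Ideal.span {γ ^ (ν - (id (m ℓ) : ℕ))}} :=
      Nat.card_congr
        { toFun := fun v => ⟨⟨v.1.1, v.2⟩, fun ℓ => v.1.2 ℓ (Set.mem_univ _)⟩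
          invFun := fun c => ⟨⟨c.1.1, fun ℓ _ => c.2 ℓ⟩, c.1.2⟩
          left_inv := fun _ => rfl
          right_inv := fun _ => rfl }
    rw [hswap] at hdual
    have hdual' := congrArg (fun x : ℕ => (x : ℚ) ^ lam) hdual
    simp only [Nat.cast_mul, mul_pow, Nat.cast_prod, Nat.cast_pow, ← Finset.prod_pow,
      ← pow_mul] at hdual'
    rw [eq_inv_mul_iff_mul_eq₀ (pow_ne_zero _ hCpos), ← hdual']
    simp
  have h := congrArg (columnSubst A⁻¹) hA_eq
  rwa [columnSubst_columnSubst, columnSubst_columnSubst, Matrix.mul_nonsing_inv _ hAunit,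
    columnSubst_one, columnSubst_one] at h

end
end
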